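/- Let w = w_t be the work function at time t ≥ 1 of a 3-server instance on the circle of circumference 2Δ with last request r = r_t, let u be a circle point, and let (x,y,z) ∈ P. If w({u,x,ȳ}) resolves from u, w({u,y,z̄}) resolves from y, and w({u,z,x̄}) resolves from z, then there exists a triple (x',y',z') ∈ P such that Φ*(w, u, x, y, z) ≥ Φ*(w, r, x', y', z'). -/

import Mathlib

open Finset

/-- Minimum-matching (Wasserstein) distance between two `k`-point configurations,
represented as `k`-tuples of points. -/
noncomputable def confDist {Ω : Type*} [MetricSpace Ω] {k : ℕ} (X Y : Fin k → Ω) : ℝ :=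
  ⨅ σ : Equiv.Perm (Fin k), ∑ i, dist (X i) (Y (σ i))

/-- The work function at time `t` of the `k`-server instance with initial configuration
`X₀` and requests `r 1, r 2, …` (the value `r 0` is unused): the least cost of serving
the first `t` requests and then moving to the configuration `X`. -/
noncomputable def workFn {Ω : Type*} [MetricSpace Ω] (k : ℕ) (X₀ : Fin k → Ω)
    (r : ℕ → Ω) (t : ℕ) (X : Fin k → Ω) : ℝ :=
  sInf { c : ℝ | ∃ Y : ℕ → Fin k → Ω, Y 0 = X₀ ∧
    (∀ i ∈ Finset.Icc 1 t, ∃ j, Y i j = r i) ∧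
    c = (∑ i ∈ Finset.Icc 1 t, confDist (Y (i - 1)) (Y i)) + confDist (Y t) X }

/-- The offline optimum of the `k`-server instance with initial configuration `X₀`
and requests `r 1, …, r T`. -/
noncomputable def opt {Ω : Type*} [MetricSpace Ω] (k : ℕ) (X₀ : Fin k → Ω)
    (r : ℕ → Ω) (T : ℕ) : ℝ :=
  sInf { c : ℝ | ∃ Y : ℕ → Fin k → Ω, Y 0 = X₀ ∧
    (∀ i ∈ Finset.Icc 1 T, ∃ j, Y i j = r i) ∧
    c = ∑ i ∈ Finset.Icc 1 T, confDist (Y (i - 1)) (Y i) }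

/-- `OPT_t(Z)`: the least cost of serving the first `t` requests while ending
in the configuration `Z`. -/
noncomputable def optTo {Ω : Type*} [MetricSpace Ω] (k : ℕ) (X₀ : Fin k → Ω)
    (r : ℕ → Ω) (t : ℕ) (Z : Fin k → Ω) : ℝ :=
  sInf { c : ℝ | ∃ Y : ℕ → Fin k → Ω, Y 0 = X₀ ∧
    (∀ i ∈ Finset.Icc 1 t, ∃ j, Y i j = r i) ∧ Y t = Z ∧
    c = ∑ i ∈ Finset.Icc 1 t, confDist (Y (i - 1)) (Y i) }

/-- `X 0, X 1, …, X T` is a run of the work function algorithm on the `k`-server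
instance with initial configuration `X₀` and requests `r 1, …, r T`. -/
def IsWFARun {Ω : Type*} [MetricSpace Ω] (k : ℕ) (X₀ : Fin k → Ω)
    (r : ℕ → Ω) (T : ℕ) (X : ℕ → Fin k → Ω) : Prop :=
  X 0 = X₀ ∧ ∀ t, 1 ≤ t → t ≤ T →
    (∃ j, X t j = r t) ∧
    ∀ Z : Fin k → Ω, (∃ j, Z j = r t) →
      optTo k X₀ r t (X t) + confDist (X t) (X (t - 1)) ≤
        optTo k X₀ r t Z + confDist Z (X (t - 1))
/-- The antipode `x̄ = x + Δ` of a point on the circle of circumference `2Δ`. -/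
noncomputable def antip (Δ : ℝ) (x : AddCircle (2*Δ)) : AddCircle (2*Δ) := x + (Δ : ℝ)

/-- The set `P`: triples of circle points not contained in any open semicircle,
i.e. with `d(x,y) + d(y,z) + d(z,x) = 2Δ`. -/
def InP (Δ : ℝ) (x y z : AddCircle (2*Δ)) : Prop :=
  dist x y + dist y z + dist z x = 2*Δ

/-- The potential `Φ*(w,u,x,y,z) = w(ū³) + w(u x ȳ) + w(u y z̄) + w(u z x̄)`. -/
noncomputable def PhiStar (Δ : ℝ) (w : (Fin 3 → AddCircle (2*Δ)) → ℝ)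
    (u x y z : AddCircle (2*Δ)) : ℝ :=
  w ![antip Δ u, antip Δ u, antip Δ u] + w ![u, x, antip Δ y]
    + w ![u, y, antip Δ z] + w ![u, z, antip Δ x]

/-- `w(X)` resolves from the `i`-th point of the configuration `X` (w.r.t. the
last request `r`): `w(X) = w(X - X i + r) + d(X i, r)`. -/
def ResolvesFrom {Ω : Type*} [MetricSpace Ω] (w : (Fin 3 → Ω) → ℝ) (r : Ω)
    (X : Fin 3 → Ω) (i : Fin 3) : Prop :=
  w X = w (Function.update X i r) + dist (X i) r

section Exchange

variable {Ω : Type*} {k : ℕ}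

/-- `σ` matches the configurations `X` and `Y` in such a way that exchanging any set of
matched pairs does not increase the sum of the values of `w`. -/
def IsExchangeMatching (w : (Fin k → Ω) → ℝ) (X Y : Fin k → Ω) (σ : Equiv.Perm (Fin k)) : Prop :=
  ∀ S : Finset (Fin k),
    w (S.piecewise X (Y ∘ σ)) + w (S.piecewise (Y ∘ σ) X) ≤ w X + w Y

/-- An exchange matching may be chosen to match a common point of the configurations. -/
theorem IsExchangeMatching.exists_apply_eq {w : (Fin k → Ω) → ℝ}
    (hw : ∀ (X : Fin k → Ω) (σ : Equiv.Perm (Fin k)), w (X ∘ σ) = w X) {X Y : Fin k → Ω}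
    {σ : Equiv.Perm (Fin k)} (hσ : IsExchangeMatching w X Y σ) {i j : Fin k} (hij : X i = Y j) :
    ∃ τ, τ i = j ∧ IsExchangeMatching w X Y τ := by
  set l := σ⁻¹ j with hl
  have hlj : σ l = j := by simp [hl]
  have key (S : Finset (Fin k)) (hS : l ∈ S) : w (S.piecewise X (Y ∘ ⇑(σ * Equiv.swap i l))) +
      w (S.piecewise (Y ∘ ⇑(σ * Equiv.swap i l)) X) ≤ w X + w Y := by
    have h1 : (insert i S).piecewise X (Y ∘ σ) =
        S.piecewise X (Y ∘ ⇑(σ * Equiv.swap i l)) := by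
      ext n
      by_cases hni : n = i
      · subst hni
        by_cases hn : n ∈ S <;> simp [Finset.piecewise, hn, hlj, hij]
      · by_cases hnl : n = l
        · subst hnl; simp [Finset.piecewise, hS]
        · simp [Finset.piecewise, hni, Equiv.swap_apply_of_ne_of_ne hni hnl]
    have h2 : (insert i S).piecewise (Y ∘ σ) X ∘ Equiv.swap i l =
        S.piecewise (Y ∘ ⇑(σ * Equiv.swap i l)) X := by
      ext n
      by_cases hni : n = i
      · subst hni
        by_cases hn : n ∈ S <;> simp [Finset.piecewise, hn, hS, hlj, hij]
      · by_cases hnl : n = l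
        · subst hnl; simp [Finset.piecewise, hS]
        · simp [Finset.piecewise, hni, Equiv.swap_apply_of_ne_of_ne hni hnl]
    rw [← h1, ← h2, hw]
    exact hσ (insert i S)
  refine ⟨σ * Equiv.swap i l, by simp [hlj], fun S => ?_⟩
  by_cases hS : l ∈ S
  · exact key S hS
  · have h := key Sᶜ (Finset.mem_compl.2 hS)
    rwa [Finset.piecewise_compl, Finset.piecewise_compl, add_comm] at h

end Exchange

section Update

variable {Ω : Type*}

theorem update_three_zero (a b c p : Ω) : Function.update ![a, b, c] 0 p = ![p, b, c] := by
  ext i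
  fin_cases i <;> rfl

theorem update_three_one (a b c p : Ω) : Function.update ![a, b, c] 1 p = ![a, p, c] := by
  ext i
  fin_cases i <;> rfl

theorem update_three_two (a b c p : Ω) : Function.update ![a, b, c] 2 p = ![a, b, p] := by
  ext i
  fin_cases i <;> rfl

end Update

section WorkFunction

variable {Ω : Type*} [MetricSpace Ω] {k : ℕ}

theorem confDist_le_sum (X Y : Fin k → Ω) (σ : Equiv.Perm (Fin k)) :
    confDist X Y ≤ ∑ i, dist (X i) (Y (σ i)) :=
  ciInf_le (Set.finite_range _).bddBelow σ

theorem exists_confDist_eq_sum (X Y : Fin k → Ω) :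
    ∃ σ : Equiv.Perm (Fin k), ∑ i, dist (X i) (Y (σ i)) = confDist X Y :=
  exists_eq_ciInf_of_finite

theorem confDist_nonneg (X Y : Fin k → Ω) : 0 ≤ confDist X Y :=
  le_ciInf fun _ => Finset.sum_nonneg fun _ _ => dist_nonneg

theorem confDist_triangle (X Y Z : Fin k → Ω) :
    confDist X Z ≤ confDist X Y + confDist Y Z := by
  obtain ⟨σ, hσ⟩ := exists_confDist_eq_sum X Y
  obtain ⟨τ, hτ⟩ := exists_confDist_eq_sum Y Z
  rw [← hσ, ← hτ, ← Equiv.sum_comp σ (fun i => dist (Y i) (Z (τ i))), ← Finset.sum_add_distrib]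
  exact (confDist_le_sum X Z (σ.trans τ)).trans
    (Finset.sum_le_sum fun i _ => dist_triangle _ _ _)

theorem confDist_comp_perm_le_zero (X : Fin k → Ω) (σ : Equiv.Perm (Fin k)) :
    confDist X (X ∘ σ) ≤ 0 :=
  (confDist_le_sum _ _ σ⁻¹).trans (by simp)

theorem sum_dist_update_add (X Y : Fin k → Ω) (i : Fin k) (p : Ω) :
    ∑ j, dist (X j) (Function.update Y i p j) + dist (X i) (Y i) =
      ∑ j, dist (X j) (Y j) + dist (X i) p := by
  rw [← Finset.add_sum_erase _ _ (Finset.mem_univ i),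
    ← Finset.add_sum_erase _ (fun j => dist (X j) (Y j)) (Finset.mem_univ i),
    Finset.sum_congr rfl fun j hj => by
      rw [Function.update_of_ne (Finset.ne_of_mem_erase hj)]]
  simp only [Function.update_self]
  ring

theorem confDist_update_le (X : Fin k → Ω) (i : Fin k) (p : Ω) :
    confDist X (Function.update X i p) ≤ dist (X i) p := by
  have h := confDist_le_sum X (Function.update X i p) 1
  have h' := sum_dist_update_add X X i p
  simp only [Equiv.Perm.one_apply, dist_self, Finset.sum_const_zero, zero_add, add_zero] at h h'
  linarith

theorem confDist_update_le' (X : Fin k → Ω) (i : Fin k) (p : Ω) :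
    confDist (Function.update X i p) X ≤ dist (X i) p := by
  have h := confDist_update_le (Function.update X i p) i (X i)
  rwa [Function.update_idem, Function.update_eq_self, Function.update_self, dist_comm] at h

/-- Removing a matched pair from an optimal matching: some point of `X` is matched to `Z j`. -/
theorem exists_confDist_update_add_dist_le (Z X : Fin k → Ω) (j : Fin k) :
    ∃ i, confDist Z (Function.update X i (Z j)) + dist (X i) (Z j) ≤ confDist Z X := by
  obtain ⟨σ, hσ⟩ := exists_confDist_eq_sum Z X
  refine ⟨σ j, ?_⟩
  have h := confDist_le_sum Z (Function.update X (σ j) (Z j)) σ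
  have h' := sum_dist_update_add Z (X ∘ σ) j (Z j)
  rw [← σ.symm_apply_apply j, ← Function.update_comp_equiv] at h'
  simp only [Function.comp_apply, Equiv.symm_apply_apply, dist_self] at h'
  rw [dist_comm (X (σ j))]
  linarith

theorem workFn_le (X₀ : Fin k → Ω) (r : ℕ → Ω) (t : ℕ) (X : Fin k → Ω) (Y : ℕ → Fin k → Ω)
    (h0 : Y 0 = X₀) (hY : ∀ i ∈ Finset.Icc 1 t, ∃ j, Y i j = r i) :
    workFn k X₀ r t X ≤
      (∑ i ∈ Finset.Icc 1 t, confDist (Y (i - 1)) (Y i)) + confDist (Y t) X := by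
  refine csInf_le ⟨0, ?_⟩ ⟨Y, h0, hY, rfl⟩
  rintro _ ⟨Y, -, -, rfl⟩
  exact add_nonneg (Finset.sum_nonneg fun _ _ => confDist_nonneg _ _) (confDist_nonneg _ _)

theorem le_workFn [NeZero k] (X₀ : Fin k → Ω) (r : ℕ → Ω) (t : ℕ) (X : Fin k → Ω) (c : ℝ)
    (h : ∀ Y : ℕ → Fin k → Ω, Y 0 = X₀ → (∀ i ∈ Finset.Icc 1 t, ∃ j, Y i j = r i) →
      c ≤ (∑ i ∈ Finset.Icc 1 t, confDist (Y (i - 1)) (Y i)) + confDist (Y t) X) :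
    c ≤ workFn k X₀ r t X := by
  refine le_csInf ⟨_, fun n => if n = 0 then X₀ else fun _ => r n, by simp, ?_, rfl⟩ ?_
  · intro i hi
    have : i ≠ 0 := by have := (Finset.mem_Icc.1 hi).1; omega
    exact ⟨0, by simp [this]⟩
  · rintro _ ⟨Y, h0, hY, rfl⟩
    exact h Y h0 hY

theorem workFn_zero [NeZero k] (X₀ : Fin k → Ω) (r : ℕ → Ω) (X : Fin k → Ω) :
    workFn k X₀ r 0 X = confDist X₀ X := by
  apply le_antisymm
  · simpa using workFn_le X₀ r 0 X (fun _ => X₀) rfl (by simp)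
  · refine le_workFn X₀ r 0 X _ fun Y h0 _ => ?_
    simp [h0]

theorem workFn_le_add_confDist [NeZero k] (X₀ : Fin k → Ω) (r : ℕ → Ω) (t : ℕ)
    (X Z : Fin k → Ω) : workFn k X₀ r t Z ≤ workFn k X₀ r t X + confDist X Z := by
  rw [← sub_le_iff_le_add]
  refine le_workFn X₀ r t X _ fun Y h0 hY => ?_
  linarith [workFn_le X₀ r t Z Y h0 hY, confDist_triangle (Y t) X Z]

theorem workFn_comp_perm [NeZero k] (X₀ : Fin k → Ω) (r : ℕ → Ω) (t : ℕ) (X : Fin k → Ω)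
    (σ : Equiv.Perm (Fin k)) : workFn k X₀ r t (X ∘ σ) = workFn k X₀ r t X := by
  apply le_antisymm
  · linarith [workFn_le_add_confDist X₀ r t X (X ∘ σ), confDist_comp_perm_le_zero X σ]
  · have h := confDist_comp_perm_le_zero (X ∘ σ) σ⁻¹
    have hX : (X ∘ σ) ∘ ⇑σ⁻¹ = X := by ext; simp
    rw [hX] at h
    linarith [workFn_le_add_confDist X₀ r t (X ∘ σ) X]

theorem workFn_update_le [NeZero k] (X₀ : Fin k → Ω) (r : ℕ → Ω) (t : ℕ) (X : Fin k → Ω)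
    (i : Fin k) (p : Ω) :
    workFn k X₀ r t (Function.update X i p) ≤ workFn k X₀ r t X + dist (X i) p := by
  linarith [workFn_le_add_confDist X₀ r t X (Function.update X i p), confDist_update_le X i p]

theorem workFn_succ_le [NeZero k] (X₀ : Fin k → Ω) (r : ℕ → Ω) (t : ℕ) (X : Fin k → Ω)
    (i : Fin k) : workFn k X₀ r (t + 1) X ≤
      workFn k X₀ r t (Function.update X i (r (t + 1))) + dist (X i) (r (t + 1)) := by
  set Z := Function.update X i (r (t + 1)) with hZ
  rw [← sub_le_iff_le_add]
  refine le_workFn X₀ r t Z _ fun Y h0 hY => ?_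
  have hlt : ∀ {n}, n ≤ t → Function.update Y (t + 1) Z n = Y n := fun h =>
    Function.update_of_ne (by omega) _ _
  have h := workFn_le X₀ r (t + 1) X (Function.update Y (t + 1) Z)
    (by rw [hlt (Nat.zero_le t), h0]) (by
      intro n hn
      rw [Finset.mem_Icc] at hn
      rcases hn.2.eq_or_lt with rfl | hlt'
      · exact ⟨i, by simp [hZ]⟩
      · rw [hlt (by omega)]
        exact hY n (Finset.mem_Icc.2 ⟨hn.1, by omega⟩))
  rw [Finset.sum_Icc_succ_top (by omega), Nat.add_sub_cancel, Function.update_self, hlt le_rfl,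
    Finset.sum_congr rfl fun n hn => by
      rw [hlt (Finset.mem_Icc.1 hn).2, hlt ((Nat.sub_le _ _).trans (Finset.mem_Icc.1 hn).2)]] at h
  linarith [confDist_update_le' X i (r (t + 1))]

theorem exists_workFn_succ_eq [NeZero k] (X₀ : Fin k → Ω) (r : ℕ → Ω) (t : ℕ) (X : Fin k → Ω) :
    ∃ i, workFn k X₀ r (t + 1) X =
      workFn k X₀ r t (Function.update X i (r (t + 1))) + dist (X i) (r (t + 1)) := by
  obtain ⟨i, hi⟩ := Finite.exists_min fun i =>
    workFn k X₀ r t (Function.update X i (r (t + 1))) + dist (X i) (r (t + 1))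
  refine ⟨i, (workFn_succ_le X₀ r t X i).antisymm ?_⟩
  refine le_workFn X₀ r (t + 1) X _ fun Y h0 hY => ?_
  obtain ⟨j, hj⟩ := hY (t + 1) (by simp)
  obtain ⟨l, hl⟩ := exists_confDist_update_add_dist_le (Y (t + 1)) X j
  rw [hj] at hl
  have h := workFn_le X₀ r t (Function.update X l (r (t + 1))) Y h0 fun n hn =>
    hY n (Finset.Icc_subset_Icc_right (Nat.le_succ t) hn)
  rw [Finset.sum_Icc_succ_top (by omega), Nat.add_sub_cancel]
  linarith [hi l, confDist_triangle (Y t) (Y (t + 1)) (Function.update X l (r (t + 1)))]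

/-- Every configuration resolves from one of its points. -/
theorem exists_workFn_eq_workFn_update_add_dist [NeZero k] (X₀ : Fin k → Ω) (r : ℕ → Ω) {t : ℕ}
    (ht : 1 ≤ t) (X : Fin k → Ω) :
    ∃ i, workFn k X₀ r t X = workFn k X₀ r t (Function.update X i (r t)) + dist (X i) (r t) := by
  obtain ⟨s, rfl⟩ := Nat.exists_eq_add_of_le' ht
  obtain ⟨i, hi⟩ := exists_workFn_succ_eq X₀ r s X
  refine ⟨i, le_antisymm ?_ ?_⟩
  · have h := workFn_update_le X₀ r (s + 1) (Function.update X i (r (s + 1))) i (X i)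
    rwa [Function.update_idem, Function.update_eq_self, Function.update_self, dist_comm] at h
  · have h := workFn_succ_le X₀ r s (Function.update X i (r (s + 1))) i
    rw [Function.update_idem, Function.update_self, dist_self, add_zero] at h
    linarith

/-- The work function is quasiconvex. -/
theorem exists_isExchangeMatching_workFn [NeZero k] (X₀ : Fin k → Ω) (r : ℕ → Ω) (t : ℕ)
    (X Y : Fin k → Ω) : ∃ σ, IsExchangeMatching (workFn k X₀ r t) X Y σ := by
  induction t generalizing X Y with
  | zero =>
    obtain ⟨α, hα⟩ := exists_confDist_eq_sum X₀ X
    obtain ⟨β, hβ⟩ := exists_confDist_eq_sum X₀ Y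
    refine ⟨β * α⁻¹, fun S => ?_⟩
    simp only [workFn_zero, ← hα, ← hβ]
    refine (add_le_add (confDist_le_sum _ _ α) (confDist_le_sum _ _ α)).trans_eq ?_
    rw [← Finset.sum_add_distrib, ← Finset.sum_add_distrib]
    refine Finset.sum_congr rfl fun i _ => ?_
    by_cases hi : α i ∈ S <;> simp [Finset.piecewise, hi, add_comm]
  | succ t ih =>
    obtain ⟨i, hi⟩ := exists_workFn_succ_eq X₀ r t X
    obtain ⟨j, hj⟩ := exists_workFn_succ_eq X₀ r t Y
    obtain ⟨σ, hσ⟩ := ih (Function.update X i (r (t + 1))) (Function.update Y j (r (t + 1)))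
    obtain ⟨τ, rfl, hτ⟩ := hσ.exists_apply_eq (workFn_comp_perm X₀ r t) (i := i) (j := j)
      (by simp)
    refine ⟨τ, fun S => ?_⟩
    have hY : Function.update Y (τ i) (r (t + 1)) ∘ τ =
        Function.update (Y ∘ τ) i (r (t + 1)) := by
      ext n
      simp [Function.update_apply]
    have hpw (A B : Fin k → Ω) : S.piecewise (Function.update A i (r (t + 1)))
        (Function.update B i (r (t + 1))) =
          Function.update (S.piecewise A B) i (r (t + 1)) := by
      ext n
      by_cases hn : n = i <;> by_cases hnS : n ∈ S <;>
        simp [Finset.piecewise, hn, hnS]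
    have h := hτ S
    rw [hY, hpw, hpw] at h
    have hd : dist (S.piecewise X (Y ∘ τ) i) (r (t + 1)) +
        dist (S.piecewise (Y ∘ τ) X i) (r (t + 1)) =
          dist (X i) (r (t + 1)) + dist (Y (τ i)) (r (t + 1)) := by
      by_cases hiS : i ∈ S <;> simp [Finset.piecewise, hiS, add_comm]
    linarith [workFn_succ_le X₀ r t (S.piecewise X (Y ∘ τ)) i,
      workFn_succ_le X₀ r t (S.piecewise (Y ∘ τ) X) i]

theorem workFn_three_swap_right (X₀ : Fin 3 → Ω) (r : ℕ → Ω) (t : ℕ) (p a b : Ω) :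
    workFn 3 X₀ r t ![p, a, b] = workFn 3 X₀ r t ![p, b, a] := by
  rw [← workFn_comp_perm X₀ r t ![p, b, a] (Equiv.swap 1 2)]
  congr 1
  ext i
  fin_cases i <;> rfl

theorem workFn_three_swap_left (X₀ : Fin 3 → Ω) (r : ℕ → Ω) (t : ℕ) (p a b : Ω) :
    workFn 3 X₀ r t ![p, a, b] = workFn 3 X₀ r t ![a, p, b] := by
  rw [← workFn_comp_perm X₀ r t ![a, p, b] (Equiv.swap 0 1)]
  congr 1
  ext i
  fin_cases i <;> rfl

theorem workFn_three_le_left (X₀ : Fin 3 → Ω) (r : ℕ → Ω) (t : ℕ) (p q a b : Ω) :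
    workFn 3 X₀ r t ![p, a, b] ≤ workFn 3 X₀ r t ![q, a, b] + dist q p := by
  simpa [update_three_zero] using workFn_update_le X₀ r t ![q, a, b] 0 p

theorem workFn_three_le_right (X₀ : Fin 3 → Ω) (r : ℕ → Ω) (t : ℕ) (p a b c : Ω) :
    workFn 3 X₀ r t ![p, a, b] ≤ workFn 3 X₀ r t ![p, a, c] + dist c b := by
  simpa [update_three_two] using workFn_update_le X₀ r t ![p, a, c] 2 b

/-- A configuration with three coinciding points resolves from each of them. -/
theorem workFn_three_self (X₀ : Fin 3 → Ω) (r : ℕ → Ω) {t : ℕ} (ht : 1 ≤ t) (a : Ω) :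
    workFn 3 X₀ r t ![a, a, a] = workFn 3 X₀ r t ![r t, a, a] + dist a (r t) := by
  obtain ⟨i, hi⟩ := exists_workFn_eq_workFn_update_add_dist X₀ r ht ![a, a, a]
  fin_cases i
  · simpa [update_three_zero] using hi
  · simpa [update_three_one, workFn_three_swap_left _ _ _ a] using hi
  · simpa [update_three_two, workFn_three_swap_right _ _ _ a a,
      workFn_three_swap_left _ _ _ a (r t)] using hi

/-- Exchange property for two three-point configurations with a common point. -/
theorem workFn_three_exchange (X₀ : Fin 3 → Ω) (r : ℕ → Ω) (t : ℕ) (p a a' b b' : Ω) :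
    workFn 3 X₀ r t ![p, a, b'] + workFn 3 X₀ r t ![p, b, a'] ≤
        workFn 3 X₀ r t ![p, a, a'] + workFn 3 X₀ r t ![p, b, b'] ∨
      workFn 3 X₀ r t ![p, a, b] + workFn 3 X₀ r t ![p, b', a'] ≤
        workFn 3 X₀ r t ![p, a, a'] + workFn 3 X₀ r t ![p, b, b'] := by
  obtain ⟨σ, hσ⟩ := exists_isExchangeMatching_workFn X₀ r t ![p, a, a'] ![p, b, b']
  obtain ⟨τ, hτ0, hτ⟩ := hσ.exists_apply_eq (workFn_comp_perm X₀ r t) (i := 0) (j := 0) rfl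
  have h := hτ {1}
  have e1 : Finset.piecewise {1} ![p, a, a'] (![p, b, b'] ∘ τ) = ![p, a, ![p, b, b'] (τ 2)] := by
    ext i
    fin_cases i <;> simp [Finset.piecewise, hτ0]
  have e2 : Finset.piecewise {1} (![p, b, b'] ∘ τ) ![p, a, a'] = ![p, ![p, b, b'] (τ 1), a'] := by
    ext i
    fin_cases i <;> simp [Finset.piecewise]
  rw [e1, e2] at h
  have h10 : τ 1 ≠ 0 := fun h => by simpa using τ.injective (h.trans hτ0.symm)
  have h20 : τ 2 ≠ 0 := fun h => by simpa using τ.injective (h.trans hτ0.symm)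
  have h12 : τ 1 ≠ τ 2 := fun h => by simpa using τ.injective h
  rcases (by omega : τ 1 = 1 ∧ τ 2 = 2 ∨ τ 1 = 2 ∧ τ 2 = 1) with ⟨h1, h2⟩ | ⟨h1, h2⟩
  · exact Or.inl (by simpa [h1, h2] using h)
  · exact Or.inr (by simpa [h1, h2] using h)

end WorkFunction

section Circle

variable {Δ : ℝ}

theorem antip_antip (x : AddCircle (2 * Δ)) : antip Δ (antip Δ x) = x := by
  rw [antip, antip, add_assoc, ← AddCircle.coe_add, ← two_mul, AddCircle.coe_period, add_zero]

theorem dist_antip_antip (x y : AddCircle (2 * Δ)) : dist (antip Δ x) (antip Δ y) = dist x y :=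
  dist_add_right _ _ _

theorem AddCircle.norm_coe_eq_min {p x : ℝ} (hx : |x| ≤ p) :
    ‖(x : AddCircle p)‖ = min |x| (p - |x|) := by
  have hp : 0 ≤ p := (abs_nonneg x).trans hx
  rcases hp.eq_or_lt with rfl | hp
  · have hx0 : x = 0 := by simpa using hx
    simp [hx0]
  rcases le_or_gt |x| (p / 2) with h | h
  · rw [min_eq_left (by linarith)]
    exact (AddCircle.norm_coe_eq_abs_iff p hp.ne').2 (by rwa [abs_of_pos hp])
  rw [min_eq_right (by linarith)]
  have key (y : ℝ) (hy : p / 2 < y) (hyp : y ≤ p) : ‖(y : AddCircle p)‖ = p - y := by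
    have h1 : |y - p| = p - y := by rw [abs_of_nonpos (by linarith)]; ring
    rw [← h1, ← (AddCircle.norm_coe_eq_abs_iff p hp.ne').2
      (by rw [h1, abs_of_pos hp]; linarith), AddCircle.coe_sub, AddCircle.coe_period, sub_zero]
  rcases abs_cases x with ⟨hx', -⟩ | ⟨hx', -⟩ <;> rw [hx'] at h hx ⊢
  · exact key x h hx
  · rw [← key (-x) h hx, AddCircle.coe_neg, norm_neg]

theorem dist_antip (hΔ : 0 < Δ) (x y : AddCircle (2 * Δ)) :
    dist x (antip Δ y) = Δ - dist x y := by
  have : Fact (0 < 2 * Δ) := ⟨by linarith⟩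
  obtain ⟨c, hc, hxy⟩ := AddCircle.coe_image_Ico_eq (2 * Δ) 0 ▸ Set.mem_univ (x - y)
  rw [zero_add, Set.mem_Ico] at hc
  rw [dist_eq_norm, dist_eq_norm, antip, ← sub_sub, ← hxy, ← AddCircle.coe_sub,
    AddCircle.norm_coe_eq_min (x := c - Δ) (by rw [abs_le]; constructor <;> linarith),
    AddCircle.norm_coe_eq_min (x := c) (by rw [abs_of_nonneg hc.1]; exact hc.2.le),
    abs_of_nonneg hc.1]
  grind

theorem inP_antip_self (hΔ : 0 < Δ) (x y : AddCircle (2 * Δ)) : InP Δ (antip Δ x) x y := by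
  have h : dist y (antip Δ x) = Δ - dist x y := by rw [dist_antip hΔ, dist_comm]
  rw [InP, dist_comm (antip Δ x), dist_antip hΔ, h, dist_self]
  ring

/-- If `(x, y, z) ∈ P` then every point `r` forms a triple of `P` with two of the three points;
if these are `y` and `z`, then `x` and `r` are on the arc opposite to that between them. -/
theorem InP.exists_mem (hΔ : 0 < Δ) {x y z : AddCircle (2 * Δ)} (h : InP Δ x y z)
    (r : AddCircle (2 * Δ)) :
    2 * Δ ≤ dist x y + dist x r + dist y r ∨ 2 * Δ ≤ dist x z + dist x r + dist z r ∨
      2 * Δ ≤ dist y z + dist y r + dist z r ∧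
        (dist x y + dist x r ≤ dist y r ∨ dist x z + dist x r ≤ dist z r) := by
  have : Fact (0 < 2 * Δ) := ⟨by linarith⟩
  have hrep (p : AddCircle (2 * Δ)) : ∃ a : ℝ, 0 ≤ a ∧ a < 2 * Δ ∧ p = x + a := by
    obtain ⟨a, ha, hp⟩ := AddCircle.coe_image_Ico_eq (2 * Δ) 0 ▸ Set.mem_univ (p - x)
    exact ⟨a, ha.1, by simpa using ha.2, by rw [hp, add_sub_cancel]⟩
  obtain ⟨a, ha0, ha, rfl⟩ := hrep y
  obtain ⟨b, hb0, hb, rfl⟩ := hrep z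
  obtain ⟨c, hc0, hc, rfl⟩ := hrep r
  have hx (s : ℝ) (h0 : 0 ≤ s) (h1 : s < 2 * Δ) : dist x (x + s) = min s (2 * Δ - s) := by
    rw [dist_self_add_right, AddCircle.norm_coe_eq_min (by rw [abs_of_nonneg h0]; exact h1.le),
      abs_of_nonneg h0]
  have hst (s t : ℝ) (h0 : 0 ≤ s) (h1 : s < 2 * Δ) (h2 : 0 ≤ t) (h3 : t < 2 * Δ) :
      dist (x + s) (x + t) = min |s - t| (2 * Δ - |s - t|) := by
    rw [dist_add_left, dist_eq_norm, ← AddCircle.coe_sub, AddCircle.norm_coe_eq_min]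
    rw [abs_le]
    constructor <;> linarith
  wlog hab : a ≤ b generalizing a b
  · have h' : InP Δ x (x + b) (x + a) := by
      rw [InP] at h ⊢
      linarith [dist_comm x (x + a), dist_comm x (x + b), dist_comm (x + a) (x + b)]
    have := this b hb0 hb a ha0 ha h' (by linarith)
    rw [dist_comm (x + (b : AddCircle (2 * Δ))) (x + a)] at this
    grind
  have hst' (s t : ℝ) (h0 : 0 ≤ s) (h2 : s ≤ t) (h1 : t < 2 * Δ) :
      dist (x + s) (x + t) = min (t - s) (2 * Δ - (t - s)) := by
    rw [hst s t h0 (by linarith) (by linarith) h1, abs_sub_comm, abs_of_nonneg (by linarith)]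
  rw [InP, dist_comm _ x, hx a ha0 ha, hx b hb0 hb, hst' a b ha0 hab hb] at h
  have haΔ : a ≤ Δ := by
    linarith [min_le_right a (2 * Δ - a), min_le_left (b - a) (2 * Δ - (b - a)),
      min_le_right b (2 * Δ - b)]
  have hbΔ : Δ ≤ b := by
    linarith [min_le_left a (2 * Δ - a), min_le_left (b - a) (2 * Δ - (b - a)),
      min_le_left b (2 * Δ - b)]
  have habΔ : b - a ≤ Δ := by
    linarith [min_le_left a (2 * Δ - a), min_le_right (b - a) (2 * Δ - (b - a)),
      min_le_right b (2 * Δ - b)]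
  rw [hx a ha0 ha, hx b hb0 hb, hx c hc0 hc, hst' a b ha0 hab hb, min_eq_left (by linarith),
    min_eq_right (a := b) (by linarith), min_eq_left (a := b - a) (by linarith)]
  rcases le_total c a with hca | hac
  · rw [dist_comm _ (x + (c : AddCircle (2 * Δ))), dist_comm _ (x + (c : AddCircle (2 * Δ))),
      hst' c a hc0 hca ha, hst' c b hc0 (by linarith) hb, min_eq_left (a := c) (by linarith),
      min_eq_left (a := a - c) (by linarith)]
    rcases le_total (b - c) Δ with hbc | hbc
    · rw [min_eq_left (by linarith)]
      exact Or.inr (Or.inl (by linarith))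
    · rw [min_eq_right (by linarith)]
      exact Or.inr (Or.inr ⟨by linarith, Or.inr (by linarith)⟩)
  rcases le_total c b with hcb | hbc
  · rw [dist_comm (x + (b : AddCircle (2 * Δ))), hst' a c ha0 hac hc, hst' c b hc0 hcb hb,
      min_eq_left (a := c - a) (by linarith), min_eq_left (a := b - c) (by linarith)]
    rcases le_total c Δ with hcΔ | hcΔ
    · rw [min_eq_left (by linarith)]
      exact Or.inr (Or.inl (by linarith))
    · rw [min_eq_right (by linarith)]
      exact Or.inl (by linarith)
  · rw [hst' a c ha0 hac hc, hst' b c hb0 hbc hc, min_eq_right (a := c) (by linarith),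
      min_eq_left (a := c - b) (by linarith)]
    rcases le_total (c - a) Δ with hcaΔ | hcaΔ
    · rw [min_eq_left (by linarith)]
      exact Or.inl (by linarith)
    · rw [min_eq_right (by linarith)]
      exact Or.inr (Or.inr ⟨by linarith, Or.inl (by linarith)⟩)

end Circle

/-- Subcase 1c: if `w(u x ȳ)` resolves from `u`, `w(u y z̄)` resolves from `y`, and
`w(u z x̄)` resolves from `z`, then there is `(x',y',z') ∈ P` with
`Φ*(w,u,x,y,z) ≥ Φ*(w,r,x',y',z')`. -/
theorem phiStar_subcase_1c (Δ : ℝ) (hΔ : 0 < Δ)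
    (X₀ : Fin 3 → AddCircle (2*Δ)) (r : ℕ → AddCircle (2*Δ)) (T t : ℕ)
    (ht : 1 ≤ t) (htT : t ≤ T) (u x y z : AddCircle (2*Δ)) (hP : InP Δ x y z)
    (h1 : ResolvesFrom (workFn 3 X₀ r t) (r t) ![u, x, antip Δ y] 0)
    (h2 : ResolvesFrom (workFn 3 X₀ r t) (r t) ![u, y, antip Δ z] 1)
    (h3 : ResolvesFrom (workFn 3 X₀ r t) (r t) ![u, z, antip Δ x] 1) :
    ∃ x' y' z' : AddCircle (2*Δ), InP Δ x' y' z' ∧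
      PhiStar Δ (workFn 3 X₀ r t) (r t) x' y' z' ≤
        PhiStar Δ (workFn 3 X₀ r t) u x y z := by
  obtain ⟨p, hp⟩ : ∃ p, workFn 3 X₀ r t ![r t, antip Δ (r t), antip Δ (r t)] +
      workFn 3 X₀ r t ![r t, u, p] + workFn 3 X₀ r t ![r t, u, antip Δ p] ≤
      workFn 3 X₀ r t ![r t, x, antip Δ y] + workFn 3 X₀ r t ![r t, u, antip Δ z] +
        workFn 3 X₀ r t ![r t, u, antip Δ x] + dist y (r t) + dist z (r t) := by
    have hr (a b) : workFn 3 X₀ r t ![r t, antip Δ (r t), antip Δ (r t)] ≤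
        workFn 3 X₀ r t ![r t, a, b] + dist (antip Δ a) (r t) + dist (antip Δ b) (r t) := by
      have h1 := workFn_three_le_right X₀ r t (r t) (antip Δ (r t)) (antip Δ (r t)) b
      have h2 := workFn_three_le_right X₀ r t (r t) b (antip Δ (r t)) a
      rw [workFn_three_swap_right _ _ _ _ b, workFn_three_swap_right _ _ _ _ b] at h2
      rw [← dist_antip_antip, antip_antip] at h1 h2
      linarith
    have hu (a b) := workFn_three_le_right X₀ r t (r t) u a b
    have hexch := workFn_three_exchange X₀ r t (r t)
    have hswap := workFn_three_swap_right X₀ r t (r t)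
    have hbar (a b) : dist (antip Δ a) b = Δ - dist a b := by
      rw [dist_comm, dist_antip hΔ, dist_comm]
    rcases hP.exists_mem hΔ (r t) with hxy | hxz | ⟨hyz, hyx | hzx⟩
    · rcases hexch x (antip Δ y) u (antip Δ z) with h | h
      · refine ⟨x, ?_⟩
        have h1 := hu x (antip Δ y)
        have h2 := hr x (antip Δ z)
        rw [antip_antip, hbar] at h2
        rw [hbar, dist_comm y] at h1
        linarith
      · refine ⟨x, ?_⟩
        have h1 := hr (antip Δ z) (antip Δ y)
        rw [antip_antip, antip_antip] at h1
        rw [hswap x u] at h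
        linarith
    · refine ⟨x, ?_⟩
      have h1 := hu x (antip Δ z)
      have h2 := hr x (antip Δ y)
      rw [antip_antip, hbar] at h2
      rw [hbar, dist_comm z] at h1
      linarith
    · rcases hexch x (antip Δ y) u (antip Δ z) with h | h
      · rcases hexch x (antip Δ z) u (antip Δ x) with h' | h'
        · refine ⟨y, ?_⟩
          have h1 := hu y (antip Δ z)
          have h2 := hr x (antip Δ x)
          rw [antip_antip, hbar] at h2
          rw [hbar, dist_comm z] at h1
          linarith
        · refine ⟨x, ?_⟩
          have h1 := hr (antip Δ x) (antip Δ z)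
          rw [antip_antip, antip_antip] at h1
          have h2 := hu (antip Δ x) (antip Δ y)
          rw [dist_antip_antip, dist_comm y] at h2
          rw [hswap x u] at h'
          linarith
      · refine ⟨x, ?_⟩
        have h1 := hr (antip Δ z) (antip Δ y)
        rw [antip_antip, antip_antip] at h1
        rw [hswap x u] at h
        linarith
    · rcases hexch x (antip Δ y) u (antip Δ x) with h | h
      · refine ⟨y, ?_⟩
        have h1 := hu y (antip Δ z)
        have h2 := hr x (antip Δ x)
        rw [antip_antip, hbar] at h2
        rw [hbar, dist_comm z] at h1
        linarith
      · refine ⟨x, ?_⟩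
        have h1 := hr (antip Δ x) (antip Δ y)
        rw [antip_antip, antip_antip] at h1
        have h2 := hu (antip Δ x) (antip Δ z)
        rw [dist_antip_antip, dist_comm z] at h2
        rw [hswap x u] at h
        linarith
  refine ⟨antip Δ u, u, antip Δ p, inP_antip_self hΔ _ _, ?_⟩
  have hself := workFn_three_self X₀ r ht (antip Δ u)
  have hr := workFn_three_le_left X₀ r t (antip Δ (r t)) (r t) (antip Δ (r t)) (antip Δ (r t))
  rw [dist_comm, dist_antip hΔ, dist_comm] at hself
  rw [dist_antip hΔ, dist_self] at hr
  simp only [ResolvesFrom, update_three_zero, update_three_one, Matrix.cons_val_zero,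
    Matrix.cons_val_one] at h1 h2 h3
  rw [workFn_three_swap_left X₀ r t u (r t)] at h2 h3
  simp only [PhiStar, antip_antip]
  rw [workFn_three_swap_right X₀ r t (r t) (antip Δ p) u]
  linarith
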